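/- arXiv:1201.2571 — 3 statements merged into one kernel-verified Lean document; each statement's English description precedes it below -/
import Mathlib

section
/- Let 1 < 2m < α < ω. Then ¬(O^α_m ≤_L O^ω_1); combined with O^ω_1 ≤_L O^α_m, this gives O^ω_1 <_L O^α_m. -/
open scoped Classical

/-- Kleene application: value of the `e`-th partial recursive function at `x`. -/
def kleene (e x : ℕ) : Part ℕ := (Denumerable.ofNat Nat.Partrec.Code e).eval x

/-- `A ∧ B = {⟨a,b⟩ | a ∈ A, b ∈ B}`. -/
def setAnd (A B : Set ℕ) : Set ℕ := {x | ∃ a ∈ A, ∃ b ∈ B, x = Nat.pair a b}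

/-- `A → B = {e | ∀ a ∈ A, e·a is defined and e·a ∈ B}`. -/
def setImp (A B : Set ℕ) : Set ℕ := {e | ∀ a ∈ A, ∃ v ∈ kleene e a, v ∈ B}

/-- `E(f) = ⋂_{p,q} ((p → q) → (f p → f q))`. -/
def Efun (f : Set ℕ → Set ℕ) : Set ℕ :=
  ⋂ (p : Set ℕ) (q : Set ℕ), setImp (setImp p q) (setImp (f p) (f q))

/-- `L(f)(p) = ⋂_q (((p → q) ∧ (f q → q)) → q)`. -/
def Lop (f : Set ℕ → Set ℕ) (p : Set ℕ) : Set ℕ :=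
  ⋂ (q : Set ℕ), setImp (setAnd (setImp p q) (setImp (f q) q)) q

/-- `L'(f)(p) = ⋂ {q | {0} ∧ p ⊆ q and {1} ∧ f q ⊆ q}`. -/
def L' (f : Set ℕ → Set ℕ) (p : Set ℕ) : Set ℕ :=
  ⋂₀ {q : Set ℕ | setAnd {0} p ⊆ q ∧ setAnd {1} (f q) ⊆ q}

/-- A sight: either `NIL` or a pair `(A, σ)` with `σ` assigning a sight to each `a ∈ A`. -/
inductive Sight : Type
  | nil : Sight
  | node (A : Set ℕ) (σ : (a : ℕ) → a ∈ A → Sight) : Sight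

/-- `S` is a `(z,θ,p)`-dedicated sight. -/
def Dedicated (B : Set ℕ) (θ : ℕ → Set (Set ℕ)) (p : Set ℕ) : ℕ → Sight → Prop
  | z, .nil => ∃ y ∈ p, z = Nat.pair 0 y
  | z, .node A σ => ∃ n ∈ B, ∃ e : ℕ, z = Nat.pair 1 (Nat.pair n e) ∧ A ∈ θ n ∧
      ∀ a (ha : a ∈ A), ∃ v ∈ kleene e a, Dedicated B θ p v (σ a ha)

/-- The tree `Tr(S)` of a sight, as a predicate on (finite) sequences. -/
inductive InTr : Sight → List ℕ → Prop
  | nil : InTr Sight.nil []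
  | emptyNode (A : Set ℕ) (σ : (a : ℕ) → a ∈ A → Sight) (hA : A = ∅) :
      InTr (Sight.node A σ) []
  | cons (A : Set ℕ) (σ : (a : ℕ) → a ∈ A → Sight) (a : ℕ) (ha : a ∈ A)
      (t : List ℕ) (h : InTr (σ a ha) t) : InTr (Sight.node A σ) (a :: t)

/-- The good leaves of (the tree of) a sight. -/
inductive IsGoodLeaf : Sight → List ℕ → Prop
  | nil : IsGoodLeaf Sight.nil []
  | cons (A : Set ℕ) (σ : (a : ℕ) → a ∈ A → Sight) (a : ℕ) (ha : a ∈ A)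
      (t : List ℕ) (h : IsGoodLeaf (σ a ha) t) : IsGoodLeaf (Sight.node A σ) (a :: t)

/-- `s` is a leaf of `Tr(S)`. -/
def IsLeaf (S : Sight) (s : List ℕ) : Prop := InTr S s ∧ ∀ a : ℕ, ¬ InTr S (s ++ [a])

/-- `Out_S(s) = {a | s∗⟨a⟩ ∈ Tr(S)}`. -/
def OutS (S : Sight) (s : List ℕ) : Set ℕ := {a | InTr S (s ++ [a])}

/-- A sight is degenerate if some leaf of its tree is not a good leaf. -/
def Degenerate (S : Sight) : Prop := ∃ s, IsLeaf S s ∧ ¬ IsGoodLeaf S s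

/-- A sight is on a family `𝒜` if all its outsets at non-leaves belong to `𝒜`. -/
def SightOn (S : Sight) (𝒜 : Set (Set ℕ)) : Prop :=
  ∀ s, InTr S s → ¬ IsLeaf S s → OutS S s ∈ 𝒜

/-- `S` is `(w,θ,p)`-supporting. -/
def Supporting (B : Set ℕ) (θ : ℕ → Set (Set ℕ)) (p : Set ℕ) (w : ℕ) (S : Sight) : Prop :=
  (∀ s, IsGoodLeaf S s → ∃ y ∈ p, Nat.pair 0 y ∈ kleene w (Encodable.encode s)) ∧
  (∀ s, InTr S s → ¬ IsGoodLeaf S s →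
    ∃ n ∈ B, Nat.pair 1 n ∈ kleene w (Encodable.encode s) ∧ OutS S s ∈ θ n)

/-- `z` is r-defined on `S` if `S` is `(z,θ,ℕ)`-dedicated for some `θ`. -/
def RDefined (z : ℕ) (S : Sight) : Prop :=
  ∃ (B : Set ℕ) (θ : ℕ → Set (Set ℕ)), B.Nonempty ∧ (∀ n ∈ B, (θ n).Nonempty) ∧
    Dedicated B θ Set.univ z S

/-- `G_θ(p) = {⟨n,e⟩ | n ∈ B, e ∈ (A → p) for some A ∈ θ(n)}`. -/
def Gtheta (B : Set ℕ) (θ : ℕ → Set (Set ℕ)) (p : Set ℕ) : Set ℕ :=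
  {z | ∃ n ∈ B, ∃ e, z = Nat.pair n e ∧ ∃ A ∈ θ n, e ∈ setImp A p}

/-- `G_𝒜(p) = ⋃_{A ∈ 𝒜} (A → p)`. -/
def GA (𝒜 : Set (Set ℕ)) (p : Set ℕ) : Set ℕ := ⋃ A ∈ 𝒜, setImp A p

/-- `𝒜 ≤_L ℬ`: the ordering of basic local operators. -/
def leL (𝒜 ℬ : Set (Set ℕ)) : Prop := ∃ z : ℕ, ∀ A ∈ 𝒜, z ∈ L' (GA ℬ) A

/-- `𝒜` has the `n`-intersection property. -/
def nIntProp (𝒜 : Set (Set ℕ)) (n : ℕ) : Prop :=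
  ∀ A : Fin n → Set ℕ, (∀ i, A i ∈ 𝒜) → (⋂ i, A i).Nonempty

/-- The segment `[α]`: `{1,…,α}` for finite `α`, and all of `ℕ` for `α = ω`. -/
def seg (α : ℕ∞) : Set ℕ :=
  WithTop.recTopCoe Set.univ (fun n => {k | 1 ≤ k ∧ k ≤ n}) α

/-- `O^α_m`: the co-`m`-tons in `[α]`. -/
def Oam (α : ℕ∞) (m : ℕ) : Set (Set ℕ) :=
  {X | X ⊆ seg α ∧ (seg α \ X).Finite ∧ (seg α \ X).ncard = m}

/-- Characteristic function: `0` on `D`, `1` off `D`. -/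
noncomputable def chiD (D : Set ℕ) : ℕ → ℕ := fun n => if n ∈ D then 0 else 1

theorem seg_nat (α : ℕ) : seg (α : ℕ∞) = ((Finset.Icc 1 α : Finset ℕ) : Set ℕ) := by
  ext k
  rw [Finset.mem_coe, Finset.mem_Icc]
  exact Iff.rfl

theorem exists_avoid (m α : ℕ) (h1 : 1 ≤ m) (h2 : m ≤ α) (n : ℕ) :
    ∃ A ∈ Oam (α : ℕ∞) m, n ∉ A := by
  have key : ∃ T ⊆ Finset.Icc 1 α, T.card = m ∧ (n ∈ Finset.Icc 1 α → n ∈ T) := by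
    by_cases hn : n ∈ Finset.Icc 1 α
    · obtain ⟨T, hT1, hT2, hT3⟩ := Finset.exists_subsuperset_card_eq
        (s := {n}) (t := Finset.Icc 1 α) (n := m) (by simpa using hn) (by simpa using h1)
        (by simpa using h2)
      exact ⟨T, hT2, hT3, fun _ => hT1 (by simp)⟩
    · obtain ⟨T, hT1, hT2⟩ := Finset.exists_subset_card_eq
        (s := Finset.Icc 1 α) (n := m) (by simpa using h2)
      exact ⟨T, hT1, hT2, fun h => absurd h hn⟩
  obtain ⟨T, hT, hc, hn⟩ := key
  have e : ((Finset.Icc 1 α : Finset ℕ) : Set ℕ) \ (((Finset.Icc 1 α : Finset ℕ) : Set ℕ) \ (T : Set ℕ)) = T := by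
    rw [Set.sdiff_sdiff_cancel_left]
    exact_mod_cast hT
  refine ⟨((Finset.Icc 1 α : Finset ℕ) : Set ℕ) \ (T : Set ℕ), ⟨?_, ?_, ?_⟩, ?_⟩
  · rw [seg_nat]; exact Set.sdiff_subset
  · rw [seg_nat, e]; exact T.finite_toSet
  · rw [seg_nat, e, Set.ncard_coe_finset, hc]
  · rintro ⟨ha, hb⟩
    exact hb (by exact_mod_cast hn (by exact_mod_cast ha))

theorem GA_mono (𝒜 : Set (Set ℕ)) {p q : Set ℕ} (h : p ⊆ q) : GA 𝒜 p ⊆ GA 𝒜 q := by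
  intro e he
  simp only [GA, Set.mem_iUnion] at he ⊢
  obtain ⟨A, hA, he⟩ := he
  refine ⟨A, hA, fun a ha => ?_⟩
  obtain ⟨v, hv, hp⟩ := he a ha
  exact ⟨v, hv, h hp⟩

theorem L'_inv (𝒜 : Set (Set ℕ)) (A : Set ℕ) (z : ℕ) (hz : z ∈ L' (GA 𝒜) A) :
    (∃ y ∈ A, z = Nat.pair 0 y) ∨ ∃ e ∈ GA 𝒜 (L' (GA 𝒜) A), z = Nat.pair 1 e := by
  have hsub : ∀ w, ((∃ y ∈ A, w = Nat.pair 0 y) ∨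
      ∃ e ∈ GA 𝒜 (L' (GA 𝒜) A), w = Nat.pair 1 e) → w ∈ L' (GA 𝒜) A := by
    rintro w (⟨y, hy, rfl⟩ | ⟨e, he, rfl⟩) q ⟨hq0, hq1⟩
    · exact hq0 ⟨0, rfl, y, hy, rfl⟩
    · exact hq1 ⟨1, rfl, e, GA_mono 𝒜 (fun x (hx : x ∈ L' (GA 𝒜) A) => hx q ⟨hq0, hq1⟩) he, rfl⟩
  refine hz {w | (∃ y ∈ A, w = Nat.pair 0 y) ∨
      ∃ e ∈ GA 𝒜 (L' (GA 𝒜) A), w = Nat.pair 1 e} ⟨?_, ?_⟩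
  · rintro w ⟨_, rfl, y, hy, rfl⟩
    exact Or.inl ⟨y, hy, rfl⟩
  · rintro w ⟨_, rfl, e, he, rfl⟩
    exact Or.inr ⟨e, GA_mono 𝒜 hsub he, rfl⟩

theorem not_leL_aux (𝒜 : Set (Set ℕ)) (hfin : 𝒜.Finite) (hav : ∀ n, ∃ A ∈ 𝒜, n ∉ A) :
    ¬ leL 𝒜 (Oam ⊤ 1) := by
  rintro ⟨z, hz⟩
  obtain ⟨A0, hA0, -⟩ := hav 0
  refine hz A0 hA0 {z | (∀ A ∈ 𝒜, z ∈ L' (GA (Oam ⊤ 1)) A) → False} ⟨?_, ?_⟩ hz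
  · rintro w ⟨_, rfl, y, hy, rfl⟩ hw
    obtain ⟨A, hA, hyA⟩ := hav y
    rcases L'_inv _ _ _ (hw A hA) with ⟨y', hy', e⟩ | ⟨e', -, e⟩
    · rw [(Nat.pair_eq_pair.1 e).2] at hyA
      exact hyA hy'
    · exact absurd (Nat.pair_eq_pair.1 e).1 (by norm_num)
  · rintro w ⟨_, rfl, e, he, rfl⟩ hw
    simp only [GA, Set.mem_iUnion] at he
    obtain ⟨B, hB, he⟩ := he
    have hcof : ∀ X ∈ Oam ⊤ 1, (Xᶜ : Set ℕ).Finite := by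
      rintro X ⟨-, hX, -⟩
      rw [Set.compl_eq_univ_sdiff]
      exact hX
    have key : ∀ A ∈ 𝒜, ∃ C ∈ Oam ⊤ 1, e ∈ setImp C (L' (GA (Oam ⊤ 1)) A) := by
      intro A hA
      rcases L'_inv _ _ _ (hw A hA) with ⟨y', -, h⟩ | ⟨e', he', h⟩
      · exact absurd (Nat.pair_eq_pair.1 h).1 (by norm_num)
      · rw [← (Nat.pair_eq_pair.1 h).2] at he'
        simp only [GA, Set.mem_iUnion] at he'
        obtain ⟨C, hC, h⟩ := he'
        exact ⟨C, hC, h⟩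
    choose! C hC hCe using key
    have hf : (Bᶜ ∪ ⋃ A ∈ 𝒜, (C A)ᶜ).Finite :=
      (hcof B hB).union (hfin.biUnion fun A hA => hcof _ (hC A hA))
    obtain ⟨a, ha⟩ := hf.exists_notMem
    simp only [Set.mem_union, Set.mem_compl_iff, Set.mem_iUnion, not_or, not_not,
      not_exists] at ha
    obtain ⟨v, hv, hq⟩ := he a ha.1
    refine hq fun A hA => ?_
    obtain ⟨v', hv', hl⟩ := hCe A hA a (ha.2 A hA)
    rwa [Part.mem_unique hv hv']

/-- Proposition 5.7: for `1 < 2m < α < ω`, `¬(O^α_m ≤_L O^ω_1)` while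
`O^ω_1 ≤_L O^α_m`; hence `O^ω_1 <_L O^α_m`. -/
theorem stmt15 (m α : ℕ) (h1 : 1 < 2 * m) (h2 : 2 * m < α) :
    ¬ leL (Oam (α : ℕ∞) m) (Oam ⊤ 1) ∧ leL (Oam ⊤ 1) (Oam (α : ℕ∞) m) := by
  have hm : 1 ≤ m := by omega
  have hma : m ≤ α := by omega
  refine ⟨not_leL_aux _ ?_ (exists_avoid m α hm hma), ?_⟩
  · refine Set.Finite.subset (s := 𝒫 (seg (α : ℕ∞))) ?_ fun X hX => hX.1
    rw [seg_nat]
    exact (Finset.finite_toSet _).finite_subsets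
  · have hp : Nat.Partrec (fun a => Part.some (Nat.pair 0 a)) :=
      Nat.Partrec.of_primrec ((Nat.Primrec.const 0).pair Nat.Primrec.id)
    obtain ⟨c, hc⟩ := Nat.Partrec.Code.exists_code.1 hp
    refine ⟨Nat.pair 1 (Encodable.encode c), fun X hX q hq => ?_⟩
    obtain ⟨-, -, hX⟩ := hX
    obtain ⟨n, hn⟩ := Set.ncard_eq_one.1 hX
    obtain ⟨A, hA, hnA⟩ := exists_avoid m α hm hma n
    refine hq.2 ⟨1, rfl, _, ?_, rfl⟩
    simp only [GA, Set.mem_iUnion]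
    refine ⟨A, hA, fun a ha => ⟨Nat.pair 0 a, ?_, hq.1 ⟨0, rfl, a, ?_, rfl⟩⟩⟩
    · rw [kleene, Denumerable.ofNat_encode, hc]
      exact Part.mem_some _
    · by_contra h
      have : a ∈ seg ⊤ \ X := ⟨trivial, h⟩
      rw [hn] at this
      exact hnA (this ▸ ha)
end

section
/- Let m ≥ 1 and m ≤ α < ω. Then ¬(O^α_m ≤_L O^{α+m}_m); combined with O^{α+m}_m ≤_L O^α_m, this gives O^{α+m}_m <_L O^α_m. -/
open scoped Classical

theorem aux_L'_zero {f : Set ℕ → Set ℕ} {p : Set ℕ} {y : ℕ} (h : y ∈ p) :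
    Nat.pair 0 y ∈ L' f p := by
  rintro q ⟨h0, h1⟩
  exact h0 ⟨0, rfl, y, h, rfl⟩

theorem aux_GA_mono {ℬ : Set (Set ℕ)} {p q : Set ℕ} (h : p ⊆ q) : GA ℬ p ⊆ GA ℬ q := by
  intro e he
  simp only [GA, Set.mem_iUnion] at he ⊢
  obtain ⟨B, hB, he⟩ := he
  refine ⟨B, hB, fun a ha => ?_⟩
  obtain ⟨v, hv, hvp⟩ := he a ha
  exact ⟨v, hv, h hvp⟩

theorem aux_L'_one {ℬ : Set (Set ℕ)} {p : Set ℕ} {e : ℕ} (h : e ∈ GA ℬ (L' (GA ℬ) p)) :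
    Nat.pair 1 e ∈ L' (GA ℬ) p := by
  rintro q ⟨h0, h1⟩
  refine h1 ⟨1, rfl, e, aux_GA_mono ?_ h, rfl⟩
  intro z hz
  exact hz q ⟨h0, h1⟩

theorem aux_L'_inv {ℬ : Set (Set ℕ)} {p : Set ℕ} {z : ℕ} (h : z ∈ L' (GA ℬ) p) :
    (∃ y ∈ p, z = Nat.pair 0 y) ∨ (∃ e ∈ GA ℬ (L' (GA ℬ) p), z = Nat.pair 1 e) := by
  refine h {z | (∃ y ∈ p, z = Nat.pair 0 y) ∨
    (∃ e ∈ GA ℬ (L' (GA ℬ) p), z = Nat.pair 1 e)} ⟨?_, ?_⟩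
  · rintro _ ⟨a, rfl, y, hy, rfl⟩
    exact Or.inl ⟨y, hy, rfl⟩
  · rintro _ ⟨a, rfl, e, he, rfl⟩
    refine Or.inr ⟨e, aux_GA_mono ?_ he, rfl⟩
    rintro w (⟨y, hy, rfl⟩ | ⟨e', he', rfl⟩)
    · exact aux_L'_zero hy
    · exact aux_L'_one he'

theorem aux_main {ℬ : Set (Set ℕ)} (r : ℕ) (hB : nIntProp ℬ (r + 1))
    (A : Fin (r + 1) → Set ℕ) (hA : ∀ x, ∃ i, x ∉ A i) (z : ℕ)
    (hz : ∀ i, z ∈ L' (GA ℬ) (A i)) : False := by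
  suffices h : z ∈ {z : ℕ | ¬ ∀ i : Fin r, z ∈ L' (GA ℬ) (A i.succ)} from
    h fun i => hz i.succ
  refine hz 0 _ ⟨?_, ?_⟩
  · rintro _ ⟨a, rfl, y, hy, rfl⟩ hall
    obtain ⟨i, hi⟩ := hA y
    refine Fin.cases (fun hi => hi hy) (fun i hi => ?_) i hi
    rcases aux_L'_inv (hall i) with ⟨y', hy', h⟩ | ⟨e', he', h⟩
    · rw [Nat.pair_eq_pair] at h
      exact hi (h.2 ▸ hy')
    · rw [Nat.pair_eq_pair] at h
      omega
  · rintro _ ⟨a, rfl, e, he, rfl⟩ hall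
    have key : ∀ i : Fin r, ∃ B ∈ ℬ, e ∈ setImp B (L' (GA ℬ) (A i.succ)) := by
      intro i
      rcases aux_L'_inv (hall i) with ⟨y', hy', h⟩ | ⟨e', he', h⟩
      · rw [Nat.pair_eq_pair] at h
        omega
      · rw [Nat.pair_eq_pair] at h
        rw [← h.2] at he'
        simpa [GA] using he'
    choose B hBm hBe using key
    have he0 : ∃ B ∈ ℬ, e ∈ setImp B {z : ℕ | ¬ ∀ i : Fin r, z ∈ L' (GA ℬ) (A i.succ)} := by
      simp only [GA, Set.mem_iUnion] at he
      obtain ⟨B, h1, h2⟩ := he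
      exact ⟨B, h1, h2⟩
    obtain ⟨B0, hB0, he0⟩ := he0
    obtain ⟨b, hb⟩ := hB (Fin.cons B0 B) (fun i => by
      refine Fin.cases ?_ (fun i => ?_) i
      · simpa using hB0
      · simpa using hBm i)
    rw [Set.mem_iInter] at hb
    obtain ⟨v, hv, hvq⟩ := he0 b (by simpa using hb 0)
    refine hvq fun i => ?_
    obtain ⟨w, hw, hwq⟩ := hBe i b (by simpa using hb i.succ)
    rwa [Part.mem_unique hv hw]

theorem aux_seg (n : ℕ) : seg (n : ℕ∞) = ((Finset.Icc 1 n : Finset ℕ) : Set ℕ) := by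
  ext k
  rw [Finset.coe_Icc]
  rfl

theorem aux_Oam {n m : ℕ} {C : Finset ℕ} (hC : C ⊆ Finset.Icc 1 n) (hc : C.card = m) :
    ((Finset.Icc 1 n \ C : Finset ℕ) : Set ℕ) ∈ Oam (n : ℕ∞) m := by
  have h : seg (n : ℕ∞) \ ((Finset.Icc 1 n \ C : Finset ℕ) : Set ℕ) = (C : Set ℕ) := by
    rw [aux_seg, ← Finset.coe_sdiff, Finset.sdiff_sdiff_eq_self hC]
  refine ⟨?_, ?_, ?_⟩
  · rw [aux_seg, Finset.coe_subset]
    exact Finset.sdiff_subset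
  · rw [h]; exact C.finite_toSet
  · rw [h, Set.ncard_coe_finset, hc]

theorem aux_Oam_inv {n m : ℕ} {X : Set ℕ} (hX : X ∈ Oam (n : ℕ∞) m) :
    ∃ C : Finset ℕ, C ⊆ Finset.Icc 1 n ∧ C.card = m ∧
      X = ((Finset.Icc 1 n \ C : Finset ℕ) : Set ℕ) := by
  obtain ⟨h1, h2, h3⟩ := hX
  rw [aux_seg] at h1
  refine ⟨h2.toFinset, ?_, ?_, ?_⟩
  · intro x hx
    rw [Set.Finite.mem_toFinset, aux_seg] at hx
    exact hx.1
  · rw [← h3, Set.ncard_eq_toFinset_card _ h2]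
  · ext x
    have := @h1 x
    simp only [Finset.coe_sdiff, Set.Finite.coe_toFinset, aux_seg, Set.mem_sdiff]
    tauto

theorem aux_int {n m k : ℕ} (h : k * m < n) : nIntProp (Oam (n : ℕ∞) m) k := by
  intro A hA
  choose C hC hc hX using fun i => aux_Oam_inv (hA i)
  have hcard : (Finset.univ.biUnion C).card < (Finset.Icc 1 n).card := by
    calc (Finset.univ.biUnion C).card ≤ ∑ i : Fin k, (C i).card := Finset.card_biUnion_le
      _ = k * m := by simp [hc]
      _ < _ := by simpa using h
  obtain ⟨x, hx, hx'⟩ := Finset.exists_mem_notMem_of_card_lt_card hcard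
  refine ⟨x, Set.mem_iInter.2 fun i => ?_⟩
  rw [hX i, Finset.mem_coe, Finset.mem_sdiff]
  exact ⟨hx, fun h' => hx' (Finset.mem_biUnion.2 ⟨i, Finset.mem_univ _, h'⟩)⟩

theorem aux_kleene (a : ℕ) :
    Nat.pair 0 a ∈ kleene (Encodable.encode
      (Nat.Partrec.Code.pair Nat.Partrec.Code.zero Nat.Partrec.Code.id)) a := by
  rw [kleene, Denumerable.ofNat_encode]
  simp [Nat.Partrec.Code.eval, Nat.Partrec.Code.eval_id, Seq.seq]
  exact Part.mem_some 0

/-- Proposition 5.8: for `1 ≤ m ≤ α < ω`, `¬(O^α_m ≤_L O^{α+m}_m)` while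
`O^{α+m}_m ≤_L O^α_m`; hence `O^{α+m}_m <_L O^α_m`. -/
theorem stmt16 (m α : ℕ) (hm : 1 ≤ m) (hα : m ≤ α) :
    ¬ leL (Oam (α : ℕ∞) m) (Oam ((α + m : ℕ) : ℕ∞) m) ∧
      leL (Oam ((α + m : ℕ) : ℕ∞) m) (Oam (α : ℕ∞) m) := by
  constructor
  · rintro ⟨z, hz⟩
    have hr : (α - 1) / m * m ≤ α - 1 := Nat.div_mul_le_self _ _
    refine aux_main (ℬ := Oam ((α + m : ℕ) : ℕ∞) m) ((α - 1) / m)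
      (aux_int (by rw [add_mul]; omega))
      (fun i => ((Finset.Icc 1 α \ Finset.Icc (min (i * m) (α - m) + 1)
        (min (i * m) (α - m) + m) : Finset ℕ) : Set ℕ)) ?_ z ?_
    · intro x
      by_cases hx : x ∈ Finset.Icc 1 α
      · rw [Finset.mem_Icc] at hx
        have hlt : (x - 1) / m < (α - 1) / m + 1 :=
          Nat.lt_succ_of_le (Nat.div_le_div_right (by omega))
        refine ⟨⟨(x - 1) / m, hlt⟩, ?_⟩
        have h1 : (x - 1) / m * m ≤ x - 1 := Nat.div_mul_le_self _ _
        have h2 : x - 1 < (x - 1) / m * m + m := Nat.lt_div_mul_add (by omega)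
        rw [Finset.mem_coe, Finset.mem_sdiff, Finset.mem_Icc, Finset.mem_Icc]
        simp only
        generalize (x - 1) / m * m = t at *
        omega
      · refine ⟨0, fun h => hx ?_⟩
        rw [Finset.mem_coe, Finset.mem_sdiff] at h
        exact h.1
    · intro i
      refine hz _ (aux_Oam ?_ ?_)
      · intro x hx
        rw [Finset.mem_Icc] at hx ⊢
        omega
      · rw [Nat.card_Icc]; omega
  · refine ⟨Nat.pair 1 (Encodable.encode
      (Nat.Partrec.Code.pair Nat.Partrec.Code.zero Nat.Partrec.Code.id)), fun A hA => ?_⟩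
    obtain ⟨C, hC, hc, rfl⟩ := aux_Oam_inv hA
    obtain ⟨D, hD1, hD2, hD3⟩ := Finset.exists_subsuperset_card_eq (n := m)
      (s := C ∩ Finset.Icc 1 α) (t := Finset.Icc 1 α) Finset.inter_subset_right
      ((Finset.card_le_card Finset.inter_subset_left).trans hc.le) (by simpa using hα)
    apply aux_L'_one
    simp only [GA, Set.mem_iUnion]
    refine ⟨_, aux_Oam hD2 hD3, fun a ha => ⟨_, aux_kleene a, aux_L'_zero ?_⟩⟩
    rw [Finset.mem_coe, Finset.mem_sdiff] at ha ⊢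
    have := ha.1
    rw [Finset.mem_Icc] at this ⊢
    exact ⟨by omega, fun h => ha.2 (hD1 (Finset.mem_inter.2 ⟨h, ha.1⟩))⟩
end

section
/- Let 1 < 2m < α ≤ ω and let 𝓕 be the family of cofinite subsets of ℕ. Then ¬(𝓕 ≤_L O^α_m); and if moreover α < ω, then also ¬(O^α_m ≤_L 𝓕), so for finite α the families 𝓕 and O^α_m are incomparable with respect to ≤_L. -/
open scoped Classical

theorem L'_zero {𝒜 : Set (Set ℕ)} {p : Set ℕ} {y : ℕ} (hy : y ∈ p) :
    Nat.pair 0 y ∈ L' (GA 𝒜) p := by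
  rintro q ⟨h0, -⟩
  exact h0 ⟨0, rfl, y, hy, rfl⟩

theorem setImp_mono {A p q : Set ℕ} (h : p ⊆ q) : setImp A p ⊆ setImp A q := by
  intro e he a ha
  obtain ⟨v, hv, hp⟩ := he a ha
  exact ⟨v, hv, h hp⟩

theorem L'_one {𝒜 : Set (Set ℕ)} {p : Set ℕ} {e : ℕ} {A : Set ℕ} (hA : A ∈ 𝒜)
    (he : e ∈ setImp A (L' (GA 𝒜) p)) : Nat.pair 1 e ∈ L' (GA 𝒜) p := by
  rintro q ⟨h0, h1⟩
  refine h1 ⟨1, rfl, e, ?_, rfl⟩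
  refine Set.mem_biUnion hA (setImp_mono ?_ he)
  intro x hx
  exact hx q ⟨h0, h1⟩

theorem L'_ind {𝒜 : Set (Set ℕ)} {p : Set ℕ} (P : ℕ → Prop)
    (h0 : ∀ y ∈ p, P (Nat.pair 0 y))
    (h1 : ∀ e, ∀ A ∈ 𝒜, e ∈ setImp A {x | P x} → P (Nat.pair 1 e))
    {z : ℕ} (hz : z ∈ L' (GA 𝒜) p) : P z := by
  refine hz {x | P x} ⟨?_, ?_⟩
  · rintro _ ⟨a, rfl, y, hy, rfl⟩
    exact h0 y hy
  · rintro _ ⟨a, rfl, e, he, rfl⟩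
    simp only [GA, Set.mem_iUnion] at he
    obtain ⟨A, hA, he⟩ := he
    exact h1 e A hA he

theorem L'_cases {𝒜 : Set (Set ℕ)} {p : Set ℕ} {z : ℕ} (hz : z ∈ L' (GA 𝒜) p) :
    (∃ y ∈ p, z = Nat.pair 0 y) ∨
      (∃ e, z = Nat.pair 1 e ∧ ∃ A ∈ 𝒜, e ∈ setImp A (L' (GA 𝒜) p)) := by
  have := L'_ind (fun z => z ∈ L' (GA 𝒜) p ∧ ((∃ y ∈ p, z = Nat.pair 0 y) ∨
      (∃ e, z = Nat.pair 1 e ∧ ∃ A ∈ 𝒜, e ∈ setImp A (L' (GA 𝒜) p))))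
      (fun y hy => ⟨L'_zero hy, Or.inl ⟨y, hy, rfl⟩⟩)
      (fun e A hA he => by
        have he' : e ∈ setImp A (L' (GA 𝒜) p) := setImp_mono (fun x hx => hx.1) he
        exact ⟨L'_one hA he', Or.inr ⟨e, rfl, A, hA, he'⟩⟩) hz
  exact this.2

theorem L'_zero_inv {𝒜 : Set (Set ℕ)} {p : Set ℕ} {y : ℕ}
    (hz : Nat.pair 0 y ∈ L' (GA 𝒜) p) : y ∈ p := by
  rcases L'_cases hz with ⟨y', hy, h⟩ | ⟨e, h, -⟩
  · rw [Nat.pair_eq_pair] at h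
    rw [h.2]; exact hy
  · rw [Nat.pair_eq_pair] at h
    exact absurd h.1 (by decide)

theorem L'_one_inv {𝒜 : Set (Set ℕ)} {p : Set ℕ} {e : ℕ}
    (hz : Nat.pair 1 e ∈ L' (GA 𝒜) p) : ∃ A ∈ 𝒜, e ∈ setImp A (L' (GA 𝒜) p) := by
  rcases L'_cases hz with ⟨y', hy, h⟩ | ⟨e', h, h'⟩
  · rw [Nat.pair_eq_pair] at h
    exact absurd h.1 (by decide)
  · rw [Nat.pair_eq_pair] at h
    rw [h.2]; exact h'

theorem seg_encard (α : ℕ∞) : (seg α).encard = α := by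
  induction α using WithTop.recTopCoe with
  | top => exact (Set.infinite_univ (α := ℕ)).encard_eq
  | coe n =>
    have : seg (WithTop.some n) = ((Finset.Icc 1 n : Finset ℕ) : Set ℕ) := by
      ext k
      rw [Finset.coe_Icc]
      exact Iff.rfl
    rw [this, Set.encard_coe_eq_coe_finsetCard]
    simp; rfl

theorem fin_block {α : ℕ∞} {m : ℕ} (h2 : (2 * m : ℕ) < α) {z : ℕ}
    (hz : z ∈ L' (GA (Oam α m)) Set.univ) :
    ∃ Y : Set ℕ, Y.Finite ∧ ∀ p, z ∈ L' (GA (Oam α m)) p → (p ∩ Y).Nonempty := by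
  refine L'_ind (fun z => ∃ Y : Set ℕ, Y.Finite ∧
    ∀ p, z ∈ L' (GA (Oam α m)) p → (p ∩ Y).Nonempty) ?_ ?_ hz
  · intro y _
    exact ⟨{y}, Set.finite_singleton y, fun p hp => ⟨y, L'_zero_inv hp, rfl⟩⟩
  · intro e A hA he
    obtain ⟨hAs, hAf, hAc⟩ := hA
    have hlt : ((m + 1 : ℕ) : ℕ∞) ≤ A.encard := by
      by_contra hcon
      have hle : A.encard ≤ m := by
        push Not at hcon
        exact Order.le_of_lt_add_one (by exact_mod_cast hcon)
      have h := Set.encard_diff_add_encard_of_subset hAs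
      rw [seg_encard, ← hAf.cast_ncard_eq, hAc] at h
      have : α ≤ (2 * m : ℕ) := by
        rw [← h, two_mul, Nat.cast_add]
        gcongr
      exact absurd h2 (not_lt.mpr this)
    obtain ⟨T, hTA, hT⟩ := Set.exists_subset_encard_eq hlt
    have hTf : T.Finite := Set.finite_of_encard_eq_coe hT
    choose! v hv Y hYf hY using he
    refine ⟨⋃ a ∈ T, Y a, hTf.biUnion (fun a ha => hYf a (hTA ha)), ?_⟩
    intro p hp
    obtain ⟨B, ⟨hBs, hBf, hBc⟩, heB⟩ := L'_one_inv hp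
    have : ∃ a ∈ T, a ∈ B := by
      by_contra hcon
      push Not at hcon
      have hsub : T ⊆ seg α \ B := fun a ha => ⟨hAs (hTA ha), hcon a ha⟩
      have := Set.encard_le_encard hsub
      rw [hT, ← hBf.cast_ncard_eq, hBc] at this
      have : m + 1 ≤ m := by exact_mod_cast this
      omega
    obtain ⟨a, haT, haB⟩ := this
    obtain ⟨w, hw, hwp⟩ := heB a haB
    have hwv : w = v a := Part.mem_unique hw (hv a (hTA haT))
    obtain ⟨y, hyp, hyY⟩ := hY a (hTA haT) p (hwv ▸ hwp)
    exact ⟨y, hyp, Set.mem_biUnion haT hyY⟩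

theorem cof_inter {p q : Set ℕ} {z : ℕ} (hz : z ∈ L' (GA {A : Set ℕ | Aᶜ.Finite}) p)
    (hz' : z ∈ L' (GA {A : Set ℕ | Aᶜ.Finite}) q) :
    z ∈ L' (GA {A : Set ℕ | Aᶜ.Finite}) (p ∩ q) := by
  refine L'_ind (fun z => z ∈ L' (GA {A : Set ℕ | Aᶜ.Finite}) q →
    z ∈ L' (GA {A : Set ℕ | Aᶜ.Finite}) (p ∩ q)) ?_ ?_ hz hz'
  · intro y hy h
    exact L'_zero ⟨hy, L'_zero_inv h⟩
  · intro e A hA he h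
    obtain ⟨B, hB, heB⟩ := L'_one_inv h
    refine L'_one (A := A ∩ B) ?_ ?_
    · change (A ∩ B)ᶜ.Finite
      rw [Set.compl_inter]
      exact Set.Finite.union hA hB
    · intro a ha
      obtain ⟨v, hv, hv'⟩ := he a ha.1
      obtain ⟨w, hw, hw'⟩ := heB a ha.2
      obtain rfl := Part.mem_unique hv hw
      exact ⟨v, hv, hv' hw'⟩

theorem cof_empty {z : ℕ} (hz : z ∈ L' (GA {A : Set ℕ | Aᶜ.Finite}) ∅) : False := by
  refine L'_ind (fun _ => False) (fun y hy => hy) ?_ hz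
  intro e A hA he
  have : A.Nonempty := by
    rw [Set.nonempty_iff_ne_empty]
    rintro rfl
    have hA' : (∅ᶜ : Set ℕ).Finite := hA
    rw [Set.compl_empty] at hA'
    exact Set.infinite_univ hA'
  obtain ⟨a, ha⟩ := this
  obtain ⟨v, -, hv⟩ := he a ha
  exact hv

theorem cof_biInter {z : ℕ} {𝒮 : Set (Set ℕ)} (hf : 𝒮.Finite) (hne : 𝒮.Nonempty)
    (h : ∀ A ∈ 𝒮, z ∈ L' (GA {A : Set ℕ | Aᶜ.Finite}) A) :
    z ∈ L' (GA {A : Set ℕ | Aᶜ.Finite}) (⋂₀ 𝒮) := by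
  induction 𝒮, hf using Set.Finite.induction_on with
  | empty => exact absurd hne (by simp)
  | @insert A s _ _ ih =>
    rw [Set.sInter_insert]
    rcases s.eq_empty_or_nonempty with rfl | hs
    · simpa using h A (by simp)
    · exact cof_inter (h A (by simp)) (ih hs (fun B hB => h B (Set.mem_insert_of_mem _ hB)))

/-- Proposition 5.11: for `1 < 2m < α ≤ ω`, `¬(𝓕 ≤_L O^α_m)` where `𝓕` is the family
of cofinite sets; and for finite `α` also `¬(O^α_m ≤_L 𝓕)`, so `𝓕` and `O^α_m` are
`≤_L`-incomparable for finite `α`. -/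
theorem stmt18 (m : ℕ) (α : ℕ∞) (h1 : 1 < 2 * m) (h2 : (2 * m : ℕ) < α) :
    ¬ leL {A : Set ℕ | Aᶜ.Finite} (Oam α m) ∧
      (α ≠ ⊤ → ¬ leL (Oam α m) {A : Set ℕ | Aᶜ.Finite}) := by
  constructor
  · rintro ⟨z, hz⟩
    obtain ⟨Y, hYf, hY⟩ := fin_block h2 (hz Set.univ (by simp))
    obtain ⟨y, hy, hy'⟩ := hY Yᶜ (hz Yᶜ (by simpa using hYf))
    exact hy hy'
  · rintro hα ⟨z, hz⟩
    have hsf : (seg α).Finite := by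
      rw [← Set.encard_lt_top_iff, seg_encard]
      exact lt_top_iff_ne_top.mpr hα
    have hOf : (Oam α m).Finite := hsf.finite_subsets.subset (fun X hX => hX.1)
    have key : ∀ x ∈ seg α, ∃ X ∈ Oam α m, x ∉ X := by
      intro x hx
      have hle : ((m : ℕ) : ℕ∞) ≤ (seg α).encard := by
        rw [seg_encard]
        refine le_trans ?_ h2.le
        exact_mod_cast (by omega : m ≤ 2 * m)
      obtain ⟨T, hxT, hT, hTc⟩ := Set.exists_superset_subset_encard_eq
        (s := {x}) (t := seg α) (k := m) (by simpa using hx)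
        (by simp; omega) hle
      have hTf : T.Finite := Set.finite_of_encard_eq_coe hTc
      refine ⟨seg α \ T, ⟨Set.diff_subset, ?_, ?_⟩, fun h => h.2 (hxT rfl)⟩
      · rw [Set.diff_diff_cancel_left hT]; exact hTf
      · rw [Set.diff_diff_cancel_left hT]
        simp [Set.ncard, hTc]
    have hsne : (seg α).Nonempty := by
      rw [← Set.encard_pos, seg_encard]
      exact lt_of_le_of_lt (zero_le) h2
    obtain ⟨x, hx⟩ := hsne
    obtain ⟨X, hX, -⟩ := key x hx
    have := cof_biInter hOf ⟨X, hX⟩ hz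
    have he : ⋂₀ (Oam α m) = ∅ := by
      rw [Set.eq_empty_iff_forall_notMem]
      intro y hy
      obtain ⟨W, hW, hyW⟩ := key y (hX.1 (hy X hX))
      exact hyW (hy W hW)
    rw [he] at this
    exact cof_empty this
end
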